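/- Let n ≥ 1 and let M be an n×n real skew-symmetric matrix (Mᵀ = −M). Then for every integer 1 ≤ i ≤ n, one has d_{i,i}(M) = d_{i−1,i}(M) + 1 if and only if d_{i,i}(M) = d_{i−1,i−1}(M) + 2. -/

import Mathlib

open Matrix

/-- `dRank M j i` is the rank of the submatrix of `M` formed by its first `j` rows
and first `i` columns (it is `0` when `j = 0` or `i = 0`). -/
noncomputable def dRank {n : ℕ} (M : Matrix (Fin n) (Fin n) ℝ) (j i : ℕ) : ℕ :=
  (M.submatrix (fun a : {a : Fin n // (a : ℕ) < j} => a.1)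
    (fun b : {b : Fin n // (b : ℕ) < i} => b.1)).rank

theorem aux_range {n k : ℕ} {V : Type*} (hk : k < n) (f : Fin n → V) :
    Set.range (fun a : {a : Fin n // (a : ℕ) < k + 1} => f a.1) =
      insert (f ⟨k, hk⟩) (Set.range (fun a : {a : Fin n // (a : ℕ) < k} => f a.1)) := by
  ext v
  simp only [Set.mem_range, Set.mem_insert_iff, Subtype.exists, exists_prop]
  constructor
  · rintro ⟨a, ha, rfl⟩
    rcases Nat.lt_succ_iff_lt_or_eq.mp ha with h | h
    · exact Or.inr ⟨a, h, rfl⟩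
    · left
      congr 1
      exact Fin.ext h
  · rintro (rfl | ⟨a, ha, rfl⟩)
    · exact ⟨⟨k, hk⟩, Nat.lt_succ_self k, rfl⟩
    · exact ⟨a, Nat.lt_succ_of_lt ha, rfl⟩

theorem aux_insert_le {V : Type*} [AddCommGroup V] [Module ℝ V] [FiniteDimensional ℝ V]
    (v : V) (S : Set V) :
    Module.finrank ℝ (Submodule.span ℝ (insert v S)) ≤
      Module.finrank ℝ (Submodule.span ℝ S) + 1 := by
  rw [Submodule.span_insert]
  have h1 := Submodule.finrank_add_le_finrank_add_finrank (Submodule.span ℝ {v})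
    (Submodule.span ℝ S)
  have h2 : Module.finrank ℝ (Submodule.span ℝ {v}) ≤ 1 := by
    simpa using finrank_span_le_card (R := ℝ) ({v} : Set V)
  omega

theorem aux_mem {V : Type*} [AddCommGroup V] [Module ℝ V] [FiniteDimensional ℝ V]
    (v : V) (S : Set V) (h : Module.finrank ℝ (Submodule.span ℝ (insert v S)) =
      Module.finrank ℝ (Submodule.span ℝ S)) : v ∈ Submodule.span ℝ S := by
  have := Submodule.eq_of_le_of_finrank_eq
    (Submodule.span_mono (R := ℝ) (Set.subset_insert v S)) h.symm
  rw [this]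
  exact Submodule.subset_span (Set.mem_insert v S)

/-- truncated row -/
def rowF {n : ℕ} (M : Matrix (Fin n) (Fin n) ℝ) (i : ℕ) (a : Fin n) :
    {b : Fin n // (b : ℕ) < i} → ℝ := fun b => M a b.1

/-- truncated column -/
def colF {n : ℕ} (M : Matrix (Fin n) (Fin n) ℝ) (j : ℕ) (b : Fin n) :
    {a : Fin n // (a : ℕ) < j} → ℝ := fun a => M a.1 b

theorem dRank_rows {n : ℕ} (M : Matrix (Fin n) (Fin n) ℝ) (j i : ℕ) :
    dRank M j i = Module.finrank ℝ (Submodule.span ℝ (Set.range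
      (fun a : {a : Fin n // (a : ℕ) < j} =>
        rowF M i a.1))) := by
  unfold dRank
  rw [rank_eq_finrank_span_row]
  rfl

theorem dRank_cols {n : ℕ} (M : Matrix (Fin n) (Fin n) ℝ) (j i : ℕ) :
    dRank M j i = Module.finrank ℝ (Submodule.span ℝ (Set.range
      (fun b : {b : Fin n // (b : ℕ) < i} =>
        colF M j b.1))) := by
  unfold dRank
  rw [rank_eq_finrank_span_cols]
  rfl

/-- Property (5): for a skew-symmetric matrix, `d_{i,i} = d_{i-1,i} + 1` iff
`d_{i,i} = d_{i-1,i-1} + 2`. -/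
theorem stmt_4 {n : ℕ} (hn : 1 ≤ n) (M : Matrix (Fin n) (Fin n) ℝ)
    (hM : Mᵀ = -M) (i : ℕ) (hi1 : 1 ≤ i) (hi : i ≤ n) :
    dRank M i i = dRank M (i - 1) i + 1 ↔ dRank M i i = dRank M (i - 1) (i - 1) + 2 := by
  obtain ⟨k, rfl⟩ : ∃ k, i = k + 1 := ⟨i - 1, by omega⟩
  have hk : k < n := hi
  simp only [Nat.add_sub_cancel]
  have hs : ∀ a b, M a b = - M b a := fun a b => by
    have := congrFun (congrFun hM b) a
    simpa using this
  have h1 : dRank M (k+1) (k+1) ≤ dRank M k (k+1) + 1 := by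
    rw [dRank_rows, dRank_rows, aux_range hk (rowF M (k+1))]
    exact aux_insert_le _ _
  have h2 : dRank M k (k+1) ≤ dRank M k k + 1 := by
    rw [dRank_cols, dRank_cols, aux_range hk (colF M k)]
    exact aux_insert_le _ _
  have h3 : dRank M k k ≤ dRank M k (k+1) := by
    rw [dRank_cols, dRank_cols, aux_range hk (colF M k)]
    exact Submodule.finrank_mono (Submodule.span_mono (Set.subset_insert _ _))
  have h4 : dRank M k (k+1) = dRank M k k → dRank M (k+1) (k+1) = dRank M k (k+1) := by
    intro h
    rw [dRank_cols, dRank_cols, aux_range hk (colF M k)] at h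
    have hm := aux_mem _ _ h
    rw [Submodule.mem_span_range_iff_exists_fun] at hm
    obtain ⟨c, hc⟩ := hm
    have hc' : ∀ a : {a : Fin n // (a : ℕ) < k},
        ∑ j : {a : Fin n // (a : ℕ) < k}, c j * M a.1 j.1 = M a.1 ⟨k, hk⟩ := fun a => by
      have := congrFun hc a
      simpa [Finset.sum_apply, colF] using this
    rw [dRank_rows, dRank_rows, aux_range hk (rowF M (k+1)), Submodule.span_insert_eq_span]
    rw [Submodule.mem_span_range_iff_exists_fun]
    refine ⟨c, ?_⟩
    ext ⟨b, hb⟩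
    simp only [Finset.sum_apply, Pi.smul_apply, smul_eq_mul, rowF]
    rcases Nat.lt_succ_iff_lt_or_eq.mp hb with h' | h'
    · rw [hs ⟨k, hk⟩ b, ← hc' ⟨b, h'⟩, ← Finset.sum_neg_distrib]
      refine Finset.sum_congr rfl fun j _ => ?_
      rw [hs j.1 b]; ring
    · have hbk : b = ⟨k, hk⟩ := Fin.ext h'
      subst hbk
      have hz : M ⟨k, hk⟩ ⟨k, hk⟩ = 0 := by
        have := hs ⟨k, hk⟩ ⟨k, hk⟩
        linarith
      rw [hz]
      simp only [← hc', Finset.mul_sum]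
      have hq : ∀ T : ℝ, T = -T → T = 0 := fun T h => by linarith
      apply hq
      conv_lhs => rw [Finset.sum_comm]
      simp only [← Finset.sum_neg_distrib]
      refine Finset.sum_congr rfl fun x _ => Finset.sum_congr rfl fun y _ => ?_
      rw [hs y.1 x.1]; ring
  omega
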